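/- Let n ≥ 1 and let s_1, …, s_{n+1} be real-valued random variables on a common probability space that are exchangeable and almost surely pairwise distinct. Define the rank R = #{ i ∈ {1, …, n+1} : s_i ≤ s_{n+1} }. Then R is uniformly distributed on {1, …, n+1}, i.e. P(R = r) = 1/(n+1) for every r ∈ {1, …, n+1}. -/

import Mathlib

open MeasureTheory

/-- A finite sequence of real-valued random variables is exchangeable if its joint
distribution is invariant under every permutation of the indices. -/
def Exchangeable {Ω : Type*} [MeasurableSpace Ω] (P : Measure Ω) {m : ℕ}
    (s : Fin m → Ω → ℝ) : Prop :=
  ∀ σ : Equiv.Perm (Fin m),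
    Measure.map (fun ω i => s (σ i) ω) P = Measure.map (fun ω i => s i ω) P

/-- The number of coordinates of `v` that are at most the `k`-th one. -/
noncomputable def rankAt {m : ℕ} (k : Fin m) (v : Fin m → ℝ) : ℕ :=
  (Finset.univ.filter (fun i => v i ≤ v k)).card

lemma rankAt_lt_rankAt {m : ℕ} {v : Fin m → ℝ} {k l : Fin m} (h : v k < v l) :
    rankAt k v < rankAt l v := by
  refine Finset.card_lt_card (Finset.ssubset_iff_subset_ne.2 ⟨fun i hi => ?_, fun heq => ?_⟩)
  · simp only [Finset.mem_filter, Finset.mem_univ, true_and] at hi ⊢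
    exact hi.trans h.le
  · have hl : l ∈ Finset.univ.filter (fun i => v i ≤ v k) := by
      rw [heq]; simp
    simp only [Finset.mem_filter, Finset.mem_univ, true_and] at hl
    exact absurd hl (not_le.2 h)

lemma rankAt_injective {m : ℕ} {v : Fin m → ℝ} (hv : Function.Injective v) :
    Function.Injective (fun k => rankAt k v) := by
  intro k l hkl
  by_contra hne
  rcases lt_or_gt_of_ne (hv.ne hne) with h | h
  · exact (rankAt_lt_rankAt h).ne hkl
  · exact (rankAt_lt_rankAt h).ne hkl.symm

lemma rankAt_mem_Icc {m : ℕ} (k : Fin m) (v : Fin m → ℝ) : rankAt k v ∈ Finset.Icc 1 m := by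
  refine Finset.mem_Icc.2 ⟨Finset.card_pos.2 ⟨k, by simp⟩, ?_⟩
  exact (Finset.card_le_univ _).trans_eq (Fintype.card_fin m)

lemma exists_rankAt_eq {m : ℕ} {v : Fin m → ℝ} (hv : Function.Injective v) {r : ℕ}
    (hr1 : 1 ≤ r) (hr2 : r ≤ m) : ∃ k, rankAt k v = r := by
  obtain ⟨k, -, hk⟩ := Finset.surj_on_of_inj_on_of_card_le (s := Finset.univ)
    (t := Finset.Icc 1 m) (fun k _ => rankAt k v) (fun k _ => rankAt_mem_Icc k v)
    (fun _ _ _ _ h => rankAt_injective hv h) (by simp) r (Finset.mem_Icc.2 ⟨hr1, hr2⟩)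
  exact ⟨k, hk.symm⟩

lemma rankAt_comp_perm {m : ℕ} (k : Fin m) (v : Fin m → ℝ) (σ : Equiv.Perm (Fin m)) :
    rankAt k (fun i => v (σ i)) = rankAt (σ k) v :=
  Finset.card_equiv σ (by simp)

lemma measurable_rankAt {m : ℕ} (k : Fin m) : Measurable (rankAt k) := by
  have h : rankAt k = fun v : Fin m → ℝ => ∑ i, if v i ≤ v k then 1 else 0 := by
    funext v
    exact Finset.card_filter _ _
  rw [h]
  exact Finset.measurable_fun_sum _ fun i _ => Measurable.ite
    (measurableSet_le (measurable_pi_apply i) (measurable_pi_apply k))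
    measurable_const measurable_const

lemma Exchangeable.measure_rankAt_eq {Ω : Type*} [MeasurableSpace Ω] {P : Measure Ω} {m : ℕ}
    {s : Fin m → Ω → ℝ} (hs : Exchangeable P s) (hmeas : ∀ i, Measurable (s i))
    (k l : Fin m) (r : ℕ) :
    P {ω | rankAt k (fun i => s i ω) = r} = P {ω | rankAt l (fun i => s i ω) = r} := by
  have hE : MeasurableSet {v : Fin m → ℝ | rankAt l v = r} :=
    measurable_rankAt l (measurableSet_singleton r)
  have h := DFunLike.congr_fun (hs (Equiv.swap l k)) {v | rankAt l v = r}
  rw [Measure.map_apply (measurable_pi_lambda _ fun i => hmeas _) hE,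
    Measure.map_apply (measurable_pi_lambda _ hmeas) hE] at h
  refine Eq.trans (congrArg P ?_) h
  ext ω
  simp [rankAt_comp_perm l (fun i => s i ω)]

/-- for exchangeable, almost surely pairwise distinct real random variables
`s 0, …, s n` (i.e. `s_1, …, s_{n+1}`), the rank
`R = #{ i : s i ≤ s (last) }` is uniform on `{1, …, n+1}`. -/
theorem stmt0 {Ω : Type*} [MeasurableSpace Ω] (P : Measure Ω) [IsProbabilityMeasure P]
    (n : ℕ) (hn : 1 ≤ n) (s : Fin (n + 1) → Ω → ℝ)
    (hmeas : ∀ i, Measurable (s i))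
    (hexch : Exchangeable P s)
    (hdist : ∀ i j : Fin (n + 1), i ≠ j → P {ω | s i ω = s j ω} = 0)
    (r : ℕ) (hr1 : 1 ≤ r) (hr2 : r ≤ n + 1) :
    P {ω | (Finset.univ.filter (fun i => s i ω ≤ s (Fin.last n) ω)).card = r}
      = 1 / (n + 1) := by
  have hinj : ∀ᵐ ω ∂P, Function.Injective (fun i => s i ω) := by
    have h : ∀ᵐ ω ∂P, ∀ i j, i ≠ j → s i ω ≠ s j ω := by
      simp only [ae_all_iff]
      intro i j hij
      simpa [ae_iff] using hdist i j hij
    filter_upwards [h] with ω hω i j hij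
    by_contra hne
    exact hω i j hne hij
  let E : Fin (n + 1) → Set Ω := fun k => {ω | rankAt k (fun i => s i ω) = r}
  have hE : ∀ k, MeasurableSet (E k) := fun k =>
    (measurable_rankAt k).comp (measurable_pi_lambda _ hmeas) (measurableSet_singleton r)
  have hdisj : Pairwise (Function.onFun (AEDisjoint P) E) := by
    intro k l hkl
    exact measure_mono_null
      (fun ω hω hi => hkl (rankAt_injective hi (hω.1.trans hω.2.symm))) (ae_iff.1 hinj)
  have hunion : P (⋃ k, E k) = 1 := by
    rw [← measure_univ (μ := P)]
    refine measure_congr (Filter.eventuallyEq_univ.2 ?_)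
    filter_upwards [hinj] with ω hω
    exact Set.mem_iUnion.2 (exists_rankAt_eq hω hr1 hr2)
  rw [measure_iUnion₀ hdisj (fun k => (hE k).nullMeasurableSet), tsum_fintype,
    Finset.sum_congr rfl fun k _ => hexch.measure_rankAt_eq hmeas k (Fin.last n) r] at hunion
  rw [Finset.sum_const, Finset.card_univ, Fintype.card_fin, nsmul_eq_mul] at hunion
  change P (E (Fin.last n)) = _
  rw [ENNReal.eq_div_iff (by simp) (by finiteness)]
  exact_mod_cast hunion
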